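/- Let G be a 2-connected graph, let B be a spanning tree of G, and let S_B be the fundamental graph of B. Let e and f be two distinct edges of B whose distance in S_B is t (necessarily t is even and t ≥ 2). Then for any labelling l of B there is a sequence of at most 3t − 3 basis exchange steps that transforms (B, l) into (B, l'), where l'(e) = l(f), l'(f) = l(e), and l' agrees with l on all other edges of B. -/

import Mathlib

open Set Function

universe u

/-- `StepsIn step n a b` means that `b` can be obtained from `a` by exactly `n` steps. -/
def StepsIn {X : Type*} (step : X → X → Prop) : ℕ → X → X → Prop
  | 0, a, b => a = b
  | n + 1, a, b => ∃ c, step a c ∧ StepsIn step n c b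

variable {V : Type u}

/-- `B` is the edge set of a spanning tree of `G`. -/
def IsSpanningTreeOf (G : SimpleGraph V) (B : Set (Sym2 V)) : Prop :=
  B ⊆ G.edgeSet ∧ (SimpleGraph.fromEdgeSet B).IsTree

/-- A labelled spanning tree of a graph `G` on `n` vertices, encoded as the injective map
sending each label `i ∈ {1, …, n-1}` to the edge carrying that label; its range must be
the edge set of a spanning tree of `G`. -/
def IsLabelledSpanningTree [Fintype V] (G : SimpleGraph V)
    (b : Fin (Fintype.card V - 1) → Sym2 V) : Prop :=
  Function.Injective b ∧ IsSpanningTreeOf G (Set.range b)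

/-- One basis exchange step between labelled spanning trees: the edge carrying label `i`
is replaced by an edge `f` of `G` not in the current tree, `f` receives label `i`, and the
result is again a spanning tree.  All other labels are unchanged. -/
def TreeStep [Fintype V] (G : SimpleGraph V)
    (b b' : Fin (Fintype.card V - 1) → Sym2 V) : Prop :=
  ∃ (i : Fin (Fintype.card V - 1)) (f : Sym2 V), f ∈ G.edgeSet ∧ f ∉ Set.range b ∧
    IsSpanningTreeOf G (Set.range (Function.update b i f)) ∧ b' = Function.update b i f

/-- Two edges of `G` lie in the same 2-connected component: they are equal or some
cycle of `G` contains both of them. -/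
def SameBlock (G : SimpleGraph V) (e f : Sym2 V) : Prop :=
  e = f ∨ ∃ (v : V) (w : G.Walk v v), w.IsCycle ∧ e ∈ w.edges ∧ f ∈ w.edges

/-- `G` is 2-connected: it is connected, has at least 3 vertices, and remains connected
after the deletion of any single vertex. -/
def TwoConnected [Fintype V] (G : SimpleGraph V) : Prop :=
  3 ≤ Fintype.card V ∧ G.Connected ∧ ∀ v : V, (G.induce {w | w ≠ v}).Connected

/-- The fundamental graph `S_B` of a spanning tree `B` of `G`: vertices are the edges of
`G`, and `e ∈ B` is joined to `f ∈ E(G) \ B` whenever `(B \ {e}) ∪ {f}` is again a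
spanning tree of `G`. -/
def treeFundGraph (G : SimpleGraph V) (B : Set (Sym2 V)) : SimpleGraph ↥G.edgeSet :=
  SimpleGraph.fromRel
    (fun e f => e.1 ∈ B ∧ f.1 ∉ B ∧ IsSpanningTreeOf G ((B \ {e.1}) ∪ {f.1}))

theorem StepsIn.trans {X : Type*} {step : X → X → Prop} {m n : ℕ} {a b c : X}
    (h₁ : StepsIn step m a b) (h₂ : StepsIn step n b c) : StepsIn step (m + n) a c := by
  induction m generalizing a with
  | zero =>
    cases h₁
    simpa using h₂
  | succ m ih =>
    obtain ⟨d, had, hd⟩ := h₁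
    rw [Nat.succ_add]
    exact ⟨d, had, ih hd⟩

theorem range_update_of_injective {ι α : Type*} [DecidableEq ι] {c : ι → α}
    (hc : Function.Injective c) (p : ι) (g : α) :
    Set.range (Function.update c p g) = (Set.range c \ {c p}) ∪ {g} := by
  ext x
  constructor
  · rintro ⟨k, rfl⟩
    by_cases hk : k = p
    · subst hk
      simp
    · left
      simpa [hk] using fun h => hk (hc h)
  · rintro (⟨⟨k, rfl⟩, hk⟩ | rfl)
    · have hkp : k ≠ p := fun h => hk (by simp [h])
      exact ⟨k, by simp [hkp]⟩
    · exact ⟨p, by simp⟩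

theorem treeFundGraph_adj_of_mem {G : SimpleGraph V} {B : Set (Sym2 V)} {e g : G.edgeSet}
    (h : (treeFundGraph G B).Adj e g) (he : e.1 ∈ B) :
    g.1 ∉ B ∧ IsSpanningTreeOf G ((B \ {e.1}) ∪ {g.1}) := by
  rcases (SimpleGraph.fromRel_adj _ _ _).1 h with ⟨-, ⟨-, h⟩ | ⟨-, h, -⟩⟩
  · exact h
  · exact absurd he h

theorem treeFundGraph_adj_of_notMem {G : SimpleGraph V} {B : Set (Sym2 V)} {g e : G.edgeSet}
    (h : (treeFundGraph G B).Adj g e) (hg : g.1 ∉ B) :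
    e.1 ∈ B ∧ IsSpanningTreeOf G ((B \ {e.1}) ∪ {g.1}) := by
  rcases (SimpleGraph.fromRel_adj _ _ _).1 h with ⟨-, ⟨h, -⟩ | ⟨h, -, h'⟩⟩
  · exact absurd h hg
  · exact ⟨h, h'⟩

theorem IsLabelledSpanningTree.comp_perm [Fintype V] {G : SimpleGraph V}
    {c : Fin (Fintype.card V - 1) → Sym2 V} (hc : IsLabelledSpanningTree G c)
    (σ : Equiv.Perm (Fin (Fintype.card V - 1))) : IsLabelledSpanningTree G (c ∘ σ) :=
  ⟨hc.1.comp σ.injective, by rw [σ.surjective.range_comp]; exact hc.2⟩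

/-- Two labels whose edges can both be exchanged for the same edge `g` outside the tree can be
swapped in three steps. -/
theorem stepsIn_three_swap [Fintype V] {G : SimpleGraph V}
    {c : Fin (Fintype.card V - 1) → Sym2 V} (hc : IsLabelledSpanningTree G c)
    {p q : Fin (Fintype.card V - 1)} (hpq : p ≠ q) {g : Sym2 V} (hgG : g ∈ G.edgeSet)
    (hg : g ∉ Set.range c)
    (hp : IsSpanningTreeOf G ((Set.range c \ {c p}) ∪ {g}))
    (hq : IsSpanningTreeOf G ((Set.range c \ {c q}) ∪ {g})) :
    StepsIn (TreeStep G) 3 c (c ∘ Equiv.swap p q) := by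
  have hinj := hc.1
  have hne : c p ≠ c q := hinj.ne hpq
  have hswap := hc.comp_perm (Equiv.swap p q)
  have hpg : c p ≠ g := fun h => hg ⟨p, h⟩
  have hqg : c q ≠ g := fun h => hg ⟨q, h⟩
  have hmid : Function.update (Function.update c p g) q (c p)
      = Function.update (c ∘ Equiv.swap p q) p g := by
    ext1 k
    by_cases hkp : k = p
    · subst hkp
      simp [hpq]
    · by_cases hkq : k = q
      · subst hkq
        simp [hkp]
      · simp [hkp, hkq, Equiv.swap_apply_of_ne_of_ne]
  have hlast : Function.update (Function.update (c ∘ Equiv.swap p q) p g) p (c q)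
      = c ∘ Equiv.swap p q := by
    rw [Function.update_idem, Function.update_eq_self_iff]
    simp
  have hmidrange : Set.range (Function.update (c ∘ Equiv.swap p q) p g)
      = (Set.range c \ {c q}) ∪ {g} := by
    rw [range_update_of_injective hswap.1, (Equiv.swap p q).surjective.range_comp]
    simp
  refine ⟨_, ⟨p, g, hgG, hg, ?_, rfl⟩, _, ⟨q, c p, hc.2.1 ⟨p, rfl⟩, ?_, ?_, rfl⟩,
    _, ⟨p, c q, hc.2.1 ⟨q, rfl⟩, ?_, ?_, rfl⟩, ?_⟩
  · rwa [range_update_of_injective hinj]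
  · rw [range_update_of_injective hinj]
    simp [hpg]
  · rwa [hmid, hmidrange]
  · rw [hmid, hmidrange]
    simp [hqg]
  · rw [hmid, hlast]
    exact hswap.2
  · change _ = _
    rw [hmid, hlast]

theorem exists_stepsIn_swap_of_walk [Fintype V] {G : SimpleGraph V} {B : Set (Sym2 V)} (t : ℕ)
    (c : Fin (Fintype.card V - 1) → Sym2 V) (hc : IsLabelledSpanningTree G c)
    (hB : Set.range c = B) (i j : Fin (Fintype.card V - 1)) (e f : G.edgeSet)
    (hei : e.1 = c i) (hfj : f.1 = c j) (hef : e ≠ f)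
    (w : (treeFundGraph G B).Walk e f) (hw : w.length = t) :
    ∃ n, n ≤ 3 * t - 3 ∧ StepsIn (TreeStep G) n c (c ∘ Equiv.swap i j) := by
  induction t using Nat.strong_induction_on generalizing c i j e f with
  | _ t ih =>
  match w, hw with
  | .nil, _ => exact absurd rfl hef
  | .cons h .nil, _ =>
    exact absurd (hB ▸ ⟨j, hfj.symm⟩) (treeFundGraph_adj_of_mem h (hB ▸ ⟨i, hei.symm⟩)).1
  | .cons (v := g) hg (.cons (v := d) hd r), hw =>
    simp only [SimpleGraph.Walk.length_cons] at hw
    obtain ⟨hgB, hge⟩ := treeFundGraph_adj_of_mem hg (hB ▸ ⟨i, hei.symm⟩)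
    obtain ⟨hdB, hgd⟩ := treeFundGraph_adj_of_notMem hd hgB
    obtain ⟨m, hm⟩ : d.1 ∈ Set.range c := hB ▸ hdB
    by_cases hmi : m = i
    · have hde : d = e := Subtype.ext (by rw [← hm, hei, hmi])
      obtain ⟨n, hn, hs⟩ :=
        ih r.length (by omega) c hc hB i j d f (by rw [← hm, hmi]) hfj (hde ▸ hef) r rfl
      exact ⟨n, by omega, hs⟩
    have hswap {c' : Fin (Fintype.card V - 1) → Sym2 V} (hc' : IsLabelledSpanningTree G c')
        (hB' : Set.range c' = B) {p q : Fin (Fintype.card V - 1)} (hpq : p ≠ q)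
        (hp : IsSpanningTreeOf G ((B \ {c' p}) ∪ {g.1}))
        (hq : IsSpanningTreeOf G ((B \ {c' q}) ∪ {g.1})) :
        StepsIn (TreeStep G) 3 c' (c' ∘ Equiv.swap p q) := by
      subst hB'
      exact stepsIn_three_swap hc' hpq g.2 hgB hp hq
    have hij : i ≠ j := fun h => hef (Subtype.ext (by rw [hei, hfj, h]))
    have him : StepsIn (TreeStep G) 3 c (c ∘ Equiv.swap i m) :=
      hswap hc hB (Ne.symm hmi) (hei ▸ hge) (hm ▸ hgd)
    by_cases hmj : m = j
    · subst hmj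
      exact ⟨3, by omega, him⟩
    have hdf : d ≠ f := fun h => hmj (hc.1 (by rw [hm, h, hfj]))
    have hr : r.length ≠ 0 := fun h => hdf (SimpleGraph.Walk.eq_of_length_eq_zero h)
    have hc₁ := hc.comp_perm (Equiv.swap i m)
    have hB₁ : Set.range (c ∘ Equiv.swap i m) = B := by
      rw [(Equiv.swap i m).surjective.range_comp, hB]
    obtain ⟨n, hn, hs⟩ := ih r.length (by omega) _ hc₁ hB₁ i j d f (by simp [hm])
      (by simp [hfj, Equiv.swap_apply_of_ne_of_ne hij.symm (Ne.symm hmj)]) hdf r rfl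
    have hc₂ := hc₁.comp_perm (Equiv.swap i j)
    have hB₂ : Set.range ((c ∘ Equiv.swap i m) ∘ Equiv.swap i j) = B := by
      rw [(Equiv.swap i j).surjective.range_comp, hB₁]
    have hjm : StepsIn (TreeStep G) 3 ((c ∘ Equiv.swap i m) ∘ Equiv.swap i j)
        (((c ∘ Equiv.swap i m) ∘ Equiv.swap i j) ∘ Equiv.swap j m) := by
      refine hswap hc₂ hB₂ (Ne.symm hmj) ?_ ?_
      · simpa [hm] using hgd
      · simpa [Equiv.swap_apply_of_ne_of_ne hmi hmj, ← hei] using hge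
    have hfinal : ((c ∘ Equiv.swap i m) ∘ Equiv.swap i j) ∘ Equiv.swap j m
        = c ∘ Equiv.swap i j := by
      ext1 k
      simp only [Function.comp_apply, Equiv.swap_apply_def]
      congr 1
      grind
    rw [hfinal] at hjm
    exact ⟨3 + n + 3, by omega, (him.trans hs).trans hjm⟩

/-- In a 2-connected graph, if the two distinct tree edges carrying
labels `i` and `j` are at distance `t` in the fundamental graph `S_B`, then at most
`3t − 3` basis exchange steps swap the two labels, leaving everything else unchanged. -/
theorem swap_labels_via_fundamental_graph [Fintype V] (G : SimpleGraph V)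
    (hG : TwoConnected G)
    (b : Fin (Fintype.card V - 1) → Sym2 V) (hb : IsLabelledSpanningTree G b)
    (i j : Fin (Fintype.card V - 1)) (hij : b i ≠ b j)
    (he : b i ∈ G.edgeSet) (hf : b j ∈ G.edgeSet) (t : ℕ)
    (hreach : (treeFundGraph G (Set.range b)).Reachable ⟨b i, he⟩ ⟨b j, hf⟩)
    (ht : (treeFundGraph G (Set.range b)).dist ⟨b i, he⟩ ⟨b j, hf⟩ = t) :
    ∃ n, n ≤ 3 * t - 3 ∧ StepsIn (TreeStep G) n b (b ∘ Equiv.swap i j) := by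
  obtain ⟨p, hp⟩ := hreach.exists_walk_length_eq_dist
  exact exists_stepsIn_swap_of_walk t b hb rfl i j _ _ rfl rfl
    (fun h => hij (congrArg Subtype.val h)) p (hp.trans ht)
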